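/- Assume Γ is Q-polynomial with respect to E. Then for all vertices x, y ∈ X with i = ∂(x,y): |X| (θ₁ − θ₂) (E x̂ ⋆ E ŷ) = θ*_{i-1} E x⁻_y + θ*_i E x⁰_y + θ*_{i+1} E x⁺_y − θ₂ θ*_i E x̂ + (θ₂ − θ₀) E ŷ. -/

import Mathlib

open Matrix Finset
open scoped Classical

/-- A distance-regular graph `Γ` with vertex set `X`, path-length distance
`G.dist`, diameter `d ≥ 2`, and intersection numbers `p h i j`. -/
structure DRG where
  X : Type
  [fin : Fintype X]
  [deceq : DecidableEq X]
  G : SimpleGraph X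
  conn : G.Connected
  d : ℕ
  d_ge_two : 2 ≤ d
  dist_le : ∀ x y : X, G.dist x y ≤ d
  dist_attained : ∃ x y : X, G.dist x y = d
  p : ℕ → ℕ → ℕ → ℕ
  dist_regular : ∀ (h i j : ℕ) (x y : X), G.dist x y = h →
    (Finset.univ.filter fun z => G.dist x z = i ∧ G.dist y z = j).card = p h i j

attribute [instance] DRG.fin DRG.deceq

namespace DRG

variable (Γ : DRG)

/-- `Γ_i(x) = {z : ∂(x,z) = i}`. -/
noncomputable def sphere (x : Γ.X) (i : ℕ) : Finset Γ.X :=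
  Finset.univ.filter fun z => Γ.G.dist x z = i

/-- The number of vertices `|X|`, as a real number. -/
noncomputable def n : ℝ := (Fintype.card Γ.X : ℝ)

/-- The `i`-th distance matrix `A_i`. -/
noncomputable def Ai (i : ℕ) : Matrix Γ.X Γ.X ℝ :=
  Matrix.of fun x y => if Γ.G.dist x y = i then (1 : ℝ) else 0

/-- The adjacency matrix `A = A_1`. -/
noncomputable def A : Matrix Γ.X Γ.X ℝ := Γ.Ai 1

/-- The all-ones matrix `J`. -/
def Jmat : Matrix Γ.X Γ.X ℝ := Matrix.of fun _ _ => (1 : ℝ)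

/-- `c_i = p^i_{1,i-1}` (so `c_0 = 0`). -/
noncomputable def c (i : ℕ) : ℝ := (Γ.p i 1 (i - 1) : ℝ)

/-- `a_i = p^i_{1,i}`. -/
noncomputable def a (i : ℕ) : ℝ := (Γ.p i 1 i : ℝ)

/-- `b_i = p^i_{1,i+1}` (so `b_d = 0`). -/
noncomputable def b (i : ℕ) : ℝ := (Γ.p i 1 (i + 1) : ℝ)

/-- The standard basis vector `x̂`. -/
noncomputable def hatv (x : Γ.X) : Γ.X → ℝ := Pi.single x 1

/-- `x⁺_y = Σ_{z ∈ Γ(x) ∩ Γ_{i+1}(y)} ẑ` where `i = ∂(x,y)`. -/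
noncomputable def plusv (x y : Γ.X) : Γ.X → ℝ :=
  ∑ z ∈ Γ.sphere x 1 ∩ Γ.sphere y (Γ.G.dist x y + 1), Γ.hatv z

/-- `x⁰_y = Σ_{z ∈ Γ(x) ∩ Γ_i(y)} ẑ` where `i = ∂(x,y)`. -/
noncomputable def zerov (x y : Γ.X) : Γ.X → ℝ :=
  ∑ z ∈ Γ.sphere x 1 ∩ Γ.sphere y (Γ.G.dist x y), Γ.hatv z

/-- `x⁻_y = Σ_{z ∈ Γ(x) ∩ Γ_{i-1}(y)} ẑ` where `i = ∂(x,y)`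
(for `i = 0` this is the zero vector, matching `Γ_{-1}(y) = ∅`). -/
noncomputable def minusv (x y : Γ.X) : Γ.X → ℝ :=
  ∑ z ∈ Γ.sphere x 1 ∩ Γ.sphere y (Γ.G.dist x y - 1), Γ.hatv z

/-- The Norton product `u ⋆ v = E (u ∘ v)`, where `∘` is the entrywise
(Hadamard) product of vectors. -/
noncomputable def norton (E : Matrix Γ.X Γ.X ℝ) (u v : Γ.X → ℝ) : Γ.X → ℝ :=
  E *ᵥ (u * v)

/-- `E 0, …, E d` is the sequence of primitive idempotents of the Bose–Mesner
algebra, with `E 0 = |X|⁻¹ J`, and `θ 0, …, θ d` are the corresponding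
(mutually distinct) eigenvalues, so that `A = Σ_i θ i • E i`. -/
def IsPrimIdemSeq (E : ℕ → Matrix Γ.X Γ.X ℝ) (θ : ℕ → ℝ) : Prop :=
  E 0 = (Γ.n)⁻¹ • Γ.Jmat ∧
  ∑ i ∈ Finset.range (Γ.d + 1), E i = 1 ∧
  (∀ i j : ℕ, i ≤ Γ.d → j ≤ Γ.d → E i * E j = if i = j then E i else 0) ∧
  Γ.A = ∑ i ∈ Finset.range (Γ.d + 1), θ i • E i ∧
  (∀ i j : ℕ, i ≤ Γ.d → j ≤ Γ.d → θ i = θ j → i = j)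

/-- `q h i j` are the Krein parameters:
`E i ∘ E j = |X|⁻¹ Σ_h q h i j • E h`, with `∘` the entrywise product. -/
def IsKrein (E : ℕ → Matrix Γ.X Γ.X ℝ) (q : ℕ → ℕ → ℕ → ℝ) : Prop :=
  ∀ i j : ℕ, i ≤ Γ.d → j ≤ Γ.d →
    Matrix.hadamard (E i) (E j) =
      (Γ.n)⁻¹ • ∑ h ∈ Finset.range (Γ.d + 1), q h i j • E h

/-- The ordering `E 1, …, E d` is `Q`-polynomial: for `0 ≤ h,i,j ≤ d`,
`q h i j = 0` if one of `h,i,j` is greater than the sum of the other two, and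
`q h i j ≠ 0` if one of `h,i,j` equals the sum of the other two. -/
def IsQPolynomial (q : ℕ → ℕ → ℕ → ℝ) : Prop :=
  ∀ h i j : ℕ, h ≤ Γ.d → i ≤ Γ.d → j ≤ Γ.d →
    ((i + j < h ∨ h + j < i ∨ h + i < j) → q h i j = 0) ∧
    ((h = i + j ∨ i = h + j ∨ j = h + i) → q h i j ≠ 0)

/-- `ts 0, …, ts d` are the (mutually distinct) dual eigenvalues associated
with `E`, i.e. `E = |X|⁻¹ Σ_i ts i • A i`.  The values `ts (-1)` and
`ts (d+1)` are arbitrary reals (indeterminates). -/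
def IsDualEigs (E : Matrix Γ.X Γ.X ℝ) (ts : ℤ → ℝ) : Prop :=
  E = (Γ.n)⁻¹ • ∑ i ∈ Finset.range (Γ.d + 1), ts i • Γ.Ai i

/-- The dual eigenvalues `ts 0, …, ts d` are mutually distinct. -/
def DualDistinct (ts : ℤ → ℝ) : Prop :=
  ∀ i j : ℕ, i ≤ Γ.d → j ≤ Γ.d → ts i = ts j → i = j

/-- `C(x,y) = E x⁻_y − c_i ((θ*_1 − θ*_{i-1})/(θ*_0 − θ*_i)) E x̂`,
where `i = ∂(x,y)`. -/
noncomputable def Cvec (E : Matrix Γ.X Γ.X ℝ) (ts : ℤ → ℝ) (x y : Γ.X) :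
    Γ.X → ℝ :=
  E *ᵥ Γ.minusv x y -
    (Γ.c (Γ.G.dist x y) *
      ((ts 1 - ts ((Γ.G.dist x y : ℤ) - 1)) / (ts 0 - ts (Γ.G.dist x y)))) •
      (E *ᵥ Γ.hatv x)

/-- `B(x,y) = E x⁺_y − b_i ((θ*_1 − θ*_{i+1})/(θ*_0 − θ*_i)) E x̂`,
where `i = ∂(x,y)`. -/
noncomputable def Bvec (E : Matrix Γ.X Γ.X ℝ) (ts : ℤ → ℝ) (x y : Γ.X) :
    Γ.X → ℝ :=
  E *ᵥ Γ.plusv x y -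
    (Γ.b (Γ.G.dist x y) *
      ((ts 1 - ts ((Γ.G.dist x y : ℤ) + 1)) / (ts 0 - ts (Γ.G.dist x y)))) •
      (E *ᵥ Γ.hatv x)

end DRG

namespace DRG

variable (Γ : DRG)

theorem n_ne_zero : Γ.n ≠ 0 := by
  have : Nonempty Γ.X := Γ.conn.nonempty
  exact Nat.cast_ne_zero.mpr Fintype.card_ne_zero

theorem A_transpose : Γ.Aᵀ = Γ.A := by
  ext x y
  simp only [A, Ai, Matrix.transpose_apply, Matrix.of_apply, Γ.G.dist_comm (u := y) (v := x)]

variable {Γ}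

theorem IsDualEigs.n_mul_apply {F : Matrix Γ.X Γ.X ℝ} {ts : ℤ → ℝ} (h : Γ.IsDualEigs F ts)
    (x y : Γ.X) : Γ.n * F x y = ts (Γ.G.dist x y) := by
  have hF : F x y = Γ.n⁻¹ * ts (Γ.G.dist x y) := by
    rw [h]
    simp [Matrix.sum_apply, Ai, Γ.dist_le x y]
  rw [hF, mul_inv_cancel_left₀ Γ.n_ne_zero]

section PrimIdem

variable {E : ℕ → Matrix Γ.X Γ.X ℝ} {θ : ℕ → ℝ}

theorem IsPrimIdemSeq.A_mul (hE : Γ.IsPrimIdemSeq E θ) {j : ℕ} (hj : j ≤ Γ.d) :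
    Γ.A * E j = θ j • E j := by
  obtain ⟨-, -, hmul, hA, -⟩ := hE
  rw [hA, Finset.sum_mul, Finset.sum_eq_single_of_mem j (by simpa [Nat.lt_succ_iff] using hj)]
  · rw [smul_mul_assoc, hmul j j hj hj, if_pos rfl]
  · intro i hi hij
    rw [smul_mul_assoc, hmul i j (by simpa [Nat.lt_succ_iff] using hi) hj, if_neg hij, smul_zero]

theorem IsPrimIdemSeq.transpose_eq (hE : Γ.IsPrimIdemSeq E θ) {j : ℕ} (hj : j ≤ Γ.d) :
    (E j)ᵀ = E j := by
  have orth : ∀ i ≤ Γ.d, i ≠ j → (E i)ᵀ * E j = 0 := by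
    intro i hi hij
    have hleft : (E i)ᵀ * Γ.A = θ i • (E i)ᵀ := by
      simpa [Matrix.transpose_mul, A_transpose] using congrArg Matrix.transpose (hE.A_mul hi)
    have hcomm : θ i • ((E i)ᵀ * E j) = θ j • ((E i)ᵀ * E j) := by
      rw [← smul_mul_assoc, ← hleft, Matrix.mul_assoc, hE.A_mul hj, mul_smul_comm]
    have hθ : θ i - θ j ≠ 0 := sub_ne_zero.mpr fun h => hij (hE.2.2.2.2 i j hi hj h)
    refine (smul_eq_zero.mp ?_).resolve_left hθ
    rw [sub_smul, hcomm, sub_self]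
  have hsum : ∑ i ∈ Finset.range (Γ.d + 1), (E i)ᵀ = 1 := by
    rw [← Matrix.transpose_sum, hE.2.1, Matrix.transpose_one]
  have hself : (E j)ᵀ * E j = E j := by
    conv_rhs => rw [← Matrix.one_mul (E j), ← hsum, Finset.sum_mul]
    rw [Finset.sum_eq_single_of_mem j (by simpa [Nat.lt_succ_iff] using hj)]
    exact fun i hi hij => orth i (by simpa [Nat.lt_succ_iff] using hi) hij
  rw [← hself, Matrix.transpose_mul, Matrix.transpose_transpose]

/-- The triple product `E₁ A*₁(y) E_j` vanishes when the Krein parameter `q¹₁ⱼ` does. -/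
theorem IsPrimIdemSeq.mul_diagonal_mul_eq_zero (hE : Γ.IsPrimIdemSeq E θ)
    {q : ℕ → ℕ → ℕ → ℝ} (hq : Γ.IsKrein E q) {j : ℕ} (hj : j ≤ Γ.d) (hq0 : q 1 1 j = 0)
    (y : Γ.X) : E 1 * Matrix.diagonal (fun z => E 1 z y) * E j = 0 := by
  have h1 : 1 ≤ Γ.d := one_le_two.trans Γ.d_ge_two
  have hmul := hE.2.2.1
  have sandwich : E 1 * Matrix.hadamard (E 1) (E j) * E 1 = 0 := by
    rw [hq 1 j h1 hj, mul_smul_comm, Finset.mul_sum, smul_mul_assoc, Finset.sum_mul,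
      Finset.sum_eq_zero, smul_zero]
    intro h hh
    rw [mul_smul_comm, hmul 1 h h1 (by simpa [Nat.lt_succ_iff] using hh)]
    split_ifs with hh1
    · rw [← hh1, hq0, zero_smul, Matrix.zero_mul]
    · rw [smul_zero, Matrix.zero_mul]
  have symm : ∀ u v, E 1 u v = E 1 v u := fun u v =>
    congrFun (congrFun (hE.transpose_eq h1) v) u
  have symm' : ∀ u v, E j u v = E j v u := fun u v =>
    congrFun (congrFun (hE.transpose_eq hj) v) u
  set D := Matrix.diagonal (fun z => E 1 z y) with hD
  have htrace : (E 1 * D * (E j * D)).trace = 0 := by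
    refine Eq.trans ?_ (congrFun (congrFun sandwich y) y)
    have hcol : ∀ (M : Matrix Γ.X Γ.X ℝ) u v, (M * D) u v = M u v * E 1 v y :=
      fun M u v => Matrix.mul_diagonal _ M u v
    generalize hF : E 1 * D = F
    generalize hF' : E j * D = F'
    simp only [Matrix.trace, Matrix.diag, Matrix.mul_apply, Matrix.hadamard_apply, Finset.sum_mul]
    simp only [← hF, ← hF', hcol]
    rw [Finset.sum_comm]
    refine Finset.sum_congr rfl fun v _ => Finset.sum_congr rfl fun u _ => ?_
    rw [symm y u, symm' v u]
    ring
  rw [← Matrix.trace_mul_conjTranspose_self_eq_zero_iff, Matrix.conjTranspose_eq_transpose_of_trivial,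
    Matrix.transpose_mul, Matrix.transpose_mul, hE.transpose_eq h1, hE.transpose_eq hj, hD,
    Matrix.diagonal_transpose, ← hD, ← htrace]
  have hEj : E j * E j = E j := by rw [hmul j j hj hj, if_pos rfl]
  have hE1 : E 1 * E 1 = E 1 := by rw [hmul 1 1 h1 h1, if_pos rfl]
  calc (E 1 * D * E j * (E j * (D * E 1))).trace
      = (E 1 * D * (E j * E j) * D * E 1).trace := by simp only [Matrix.mul_assoc]
    _ = (E 1 * (E 1 * D * (E j * E j) * D)).trace := Matrix.trace_mul_comm _ _
    _ = (E 1 * E 1 * D * (E j * E j * D)).trace := by simp only [Matrix.mul_assoc]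
    _ = _ := by rw [hEj, hE1]

/-- Only `E₀`, `E₁`, `E₂` contribute to `E₁ A*₁(y) (A - θ₂ I)`, and the term from `E₂` cancels. -/
theorem IsPrimIdemSeq.mul_diagonal_mul_A_sub (hE : Γ.IsPrimIdemSeq E θ)
    {q : ℕ → ℕ → ℕ → ℝ} (hq : Γ.IsKrein E q) (hQ : Γ.IsQPolynomial q) (y : Γ.X) :
    E 1 * Matrix.diagonal (fun z => E 1 z y) * (Γ.A - θ 2 • 1) =
      (θ 0 - θ 2) • (E 1 * Matrix.diagonal (fun z => E 1 z y) * E 0) +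
        (θ 1 - θ 2) • (E 1 * Matrix.diagonal (fun z => E 1 z y) * E 1) := by
  have h2 := Γ.d_ge_two
  have hA : Γ.A - θ 2 • 1 = ∑ j ∈ Finset.range (Γ.d + 1), (θ j - θ 2) • E j := by
    rw [hE.2.2.2.1, ← hE.2.1, Finset.smul_sum, ← Finset.sum_sub_distrib]
    simp only [sub_smul]
  rw [hA, Finset.mul_sum]
  simp only [mul_smul_comm]
  rw [← Finset.sum_subset (s₁ := Finset.range 2), Finset.sum_range_succ, Finset.sum_range_one]
  · exact Finset.range_subset_range.mpr (by omega)
  · intro j hj hj2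
    simp only [Finset.mem_range] at hj hj2
    obtain rfl | hj3 : j = 2 ∨ 2 < j := by omega
    · rw [sub_self, zero_smul]
    · rw [hE.mul_diagonal_mul_eq_zero hq (by omega)
        ((hQ 1 1 j (by omega) (by omega) (by omega)).1 (by omega)) y, smul_zero]

end PrimIdem

theorem mulVec_hatv (M : Matrix Γ.X Γ.X ℝ) (x : Γ.X) : M *ᵥ Γ.hatv x = fun z => M z x := by
  ext z
  simp [hatv]

theorem sum_hatv_apply (s : Finset Γ.X) (z : Γ.X) :
    (∑ w ∈ s, Γ.hatv w) z = if z ∈ s then 1 else 0 := by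
  simp [Finset.sum_apply, hatv, Pi.single_apply]

/-- Neighbours of `x` are distributed over the three spheres around `y`. -/
theorem weighted_neighbours_eq (f : ℤ → ℝ) (x y : Γ.X) :
    f ((Γ.G.dist x y : ℤ) - 1) • Γ.minusv x y + f (Γ.G.dist x y) • Γ.zerov x y +
        f ((Γ.G.dist x y : ℤ) + 1) • Γ.plusv x y =
      fun z => f (Γ.G.dist z y) * Γ.A z x := by
  ext z
  simp only [minusv, zerov, plusv, Pi.add_apply, Pi.smul_apply, sum_hatv_apply, smul_eq_mul,
    sphere, Finset.mem_inter, Finset.mem_filter, Finset.mem_univ, true_and, A, Ai, Matrix.of_apply]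
  rw [Γ.G.dist_comm (u := z) (v := x), Γ.G.dist_comm (u := z) (v := y)]
  by_cases hxz : Γ.G.dist x z = 1
  · have t1 := Γ.conn.dist_triangle (u := x) (v := z) (w := y)
    have t2 := Γ.conn.dist_triangle (u := z) (v := x) (w := y)
    rw [Γ.G.dist_comm (u := z) (v := y)] at t1 t2
    rw [Γ.G.dist_comm (u := z) (v := x)] at t2
    have hzero : Γ.G.dist x y = 0 → Γ.G.dist y z = 1 := fun h => by
      rwa [← Γ.conn.dist_eq_zero_iff.mp h]
    generalize Γ.G.dist x y = i at *
    generalize Γ.G.dist y z = k at *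
    simp only [hxz, true_and, if_true]
    obtain h | h | h : k + 1 = i ∨ k = i ∨ k = i + 1 := by omega
    · subst h
      have : k ≠ k + 1 + 1 := by omega
      simp [this]
    · subst h
      have : k ≠ k - 1 := by omega
      simp [this]
    · subst h
      have : i + 1 ≠ i - 1 := by omega
      simp [this]
  · simp [hxz]

end DRG

/-- eq. (3.11): `|X|(θ₁ − θ₂) (E x̂ ⋆ E ŷ) = θ*_{i-1} E x⁻_y
+ θ*_i E x⁰_y + θ*_{i+1} E x⁺_y − θ₂ θ*_i E x̂ + (θ₂ − θ₀) E ŷ`. -/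
theorem DRG.norton_product_unsolved (Γ : DRG) (E : ℕ → Matrix Γ.X Γ.X ℝ) (θ : ℕ → ℝ)
    (hE : Γ.IsPrimIdemSeq E θ)
    (q : ℕ → ℕ → ℕ → ℝ) (hq : Γ.IsKrein E q) (hQ : Γ.IsQPolynomial q)
    (ts : ℤ → ℝ) (hts : Γ.IsDualEigs (E 1) ts) (hts' : Γ.DualDistinct ts) (x y : Γ.X) :
    (Γ.n * (θ 1 - θ 2)) •
        Γ.norton (E 1) (E 1 *ᵥ Γ.hatv x) (E 1 *ᵥ Γ.hatv y) =
      ts ((Γ.G.dist x y : ℤ) - 1) • (E 1 *ᵥ Γ.minusv x y) +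
        ts (Γ.G.dist x y) • (E 1 *ᵥ Γ.zerov x y) +
        ts ((Γ.G.dist x y : ℤ) + 1) • (E 1 *ᵥ Γ.plusv x y) -
        (θ 2 * ts (Γ.G.dist x y)) • (E 1 *ᵥ Γ.hatv x) +
        (θ 2 - θ 0) • (E 1 *ᵥ Γ.hatv y) := by
  have hn := Γ.n_ne_zero
  have hEts : ∀ z, ts (Γ.G.dist z y) = Γ.n * E 1 z y := fun z => (hts.n_mul_apply z y).symm
  set D := Matrix.diagonal (fun z => E 1 z y) with hD
  have hnorton : Γ.norton (E 1) (E 1 *ᵥ Γ.hatv x) (E 1 *ᵥ Γ.hatv y) =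
      (E 1 * D * E 1) *ᵥ Γ.hatv x := by
    rw [norton, ← Matrix.mulVec_mulVec, ← Matrix.mulVec_mulVec]
    congr 1
    ext z
    simp [mulVec_hatv, hD, Matrix.mulVec_diagonal, mul_comm]
  have hneigh : ts ((Γ.G.dist x y : ℤ) - 1) • (E 1 *ᵥ Γ.minusv x y) +
      ts (Γ.G.dist x y) • (E 1 *ᵥ Γ.zerov x y) +
      ts ((Γ.G.dist x y : ℤ) + 1) • (E 1 *ᵥ Γ.plusv x y) =
      Γ.n • ((E 1 * D * Γ.A) *ᵥ Γ.hatv x) := by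
    rw [← Matrix.mulVec_smul, ← Matrix.mulVec_smul, ← Matrix.mulVec_smul, ← Matrix.mulVec_add,
      ← Matrix.mulVec_add, weighted_neighbours_eq, ← Matrix.mulVec_mulVec,
      ← Matrix.mulVec_mulVec, ← Matrix.mulVec_smul]
    congr 1
    ext z
    simp [mulVec_hatv, hD, Matrix.mulVec_diagonal, hEts, mul_assoc]
  have hbase : ts (Γ.G.dist x y) • (E 1 *ᵥ Γ.hatv x) =
      Γ.n • ((E 1 * D) *ᵥ Γ.hatv x) := by
    rw [← Matrix.mulVec_smul, ← Matrix.mulVec_mulVec, ← Matrix.mulVec_smul]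
    congr 1
    ext z
    by_cases hz : z = x
    · subst hz
      simp [hatv, hD, hEts]
    · simp [hatv, hD, hz]
  have h1 : 1 ≤ Γ.d := one_le_two.trans Γ.d_ge_two
  have hJ : Γ.n • ((E 1 * D * E 0) *ᵥ Γ.hatv x) = E 1 *ᵥ Γ.hatv y := by
    have hcol : Γ.n • (D *ᵥ E 0 *ᵥ Γ.hatv x) = E 1 *ᵥ Γ.hatv y := by
      ext z
      simp only [mulVec_hatv, hD, Pi.smul_apply, Matrix.mulVec_diagonal, hE.1, Jmat,
        Matrix.smul_apply, Matrix.of_apply, smul_eq_mul]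
      field_simp
    rw [← Matrix.mulVec_mulVec, ← Matrix.mulVec_mulVec, ← Matrix.mulVec_smul, hcol,
      Matrix.mulVec_mulVec, hE.2.2.1 1 1 h1 h1, if_pos rfl]
  have key := congrArg (fun M => Γ.n • (M *ᵥ Γ.hatv x)) (hE.mul_diagonal_mul_A_sub hq hQ y)
  simp only [← hD, Matrix.mul_sub, Matrix.mul_smul, Matrix.mul_one, Matrix.sub_mulVec,
    Matrix.add_mulVec, Matrix.smul_mulVec, smul_sub, smul_add] at key
  rw [smul_comm Γ.n (θ 0 - θ 2), hJ] at key
  rw [hneigh, hnorton, mul_smul (θ 2), hbase, mul_smul Γ.n, smul_comm (θ 2) Γ.n, key]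
  module
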